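/- Let Ω be the planar angular sector {(r,θ) : 0 ≤ r ≤ R, −θ₁ ≤ θ ≤ θ₁} with θ₁ ∈ (0, π/4]. Then min over x₀ ∈ closure(Ω) of max over x ∈ ∂Ω of ⟨x − x₀, ν(x)⟩ equals R·tan(θ₁)/(1 + tan(θ₁)), attained at x₀ on the bisector at distance r₀ = R/(cos θ₁ + sin θ₁) from the vertex. -/

import Mathlib

open MeasureTheory Real

/-- for the planar angular sector of aperture `2θ₁` (with
`θ₁ ∈ (0, π/4]`) and radius `R`, the min over `x₀ ∈ closure Ω` of the max over
`x ∈ ∂Ω` of `⟪x - x₀, ν x⟫` equals `R·tan θ₁/(1 + tan θ₁)`, attained at the point of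
the bisector at distance `R/(cos θ₁ + sin θ₁)` from the vertex. -/
theorem stmt16 (R θ₁ : ℝ) (hR : 0 < R) (hθ : θ₁ ∈ Set.Ioc (0 : ℝ) (π / 4))
    (bd : Set (ℝ × ℝ))
    (hbd : bd = ((fun r : ℝ => ((r * Real.cos θ₁, -(r * Real.sin θ₁)) : ℝ × ℝ)) '' Set.Icc 0 R)
      ∪ ((fun r : ℝ => ((r * Real.cos θ₁, r * Real.sin θ₁) : ℝ × ℝ)) '' Set.Icc 0 R)
      ∪ ((fun θ : ℝ => ((R * Real.cos θ, R * Real.sin θ) : ℝ × ℝ)) '' Set.Icc (-θ₁) θ₁))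
    (Ωcl : Set (ℝ × ℝ))
    (hΩcl : Ωcl = {q : ℝ × ℝ | ∃ r θ : ℝ, r ∈ Set.Icc (0 : ℝ) R ∧ θ ∈ Set.Icc (-θ₁) θ₁ ∧
      q = (r * Real.cos θ, r * Real.sin θ)})
    (ν : ℝ × ℝ → ℝ × ℝ)
    (hν : ∀ p ∈ bd, ν p =
      if p.1 ^ 2 + p.2 ^ 2 = R ^ 2 then (p.1 / R, p.2 / R)
      else if p.2 ≤ 0 then (-Real.sin θ₁, -Real.cos θ₁)
      else (-Real.sin θ₁, Real.cos θ₁))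
    (g : ℝ × ℝ → ℝ)
    (hg : ∀ x₀ : ℝ × ℝ, g x₀ = ⨆ x : bd,
      (((x : ℝ × ℝ).1 - x₀.1) * (ν x).1 + ((x : ℝ × ℝ).2 - x₀.2) * (ν x).2)) :
    (∀ x₀ ∈ Ωcl, R * Real.tan θ₁ / (1 + Real.tan θ₁) ≤ g x₀) ∧
    g (R / (Real.cos θ₁ + Real.sin θ₁), 0) = R * Real.tan θ₁ / (1 + Real.tan θ₁) ∧
    ((R / (Real.cos θ₁ + Real.sin θ₁), 0) : ℝ × ℝ) ∈ Ωcl := by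
  obtain ⟨hθ0, hθ1⟩ := hθ
  have hs : 0 < Real.sin θ₁ := Real.sin_pos_of_pos_of_lt_pi hθ0 (by linarith [Real.pi_pos])
  have hc : 0 < Real.cos θ₁ :=
    Real.cos_pos_of_mem_Ioo ⟨by linarith [Real.pi_pos], by linarith [Real.pi_pos]⟩
  have hsc : Real.sin θ₁ ^ 2 + Real.cos θ₁ ^ 2 = 1 := Real.sin_sq_add_cos_sq θ₁
  have htan : R * Real.tan θ₁ / (1 + Real.tan θ₁)
      = R * Real.sin θ₁ / (Real.cos θ₁ + Real.sin θ₁) := by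
    rw [Real.tan_eq_sin_div_cos]
    field_simp
  have hsum : 1 ≤ Real.cos θ₁ + Real.sin θ₁ := by nlinarith
  rw [htan]
  have hlow_mem : ∀ r ∈ Set.Icc 0 R, (r * Real.cos θ₁, -(r * Real.sin θ₁)) ∈ bd := fun r hr => by
    rw [hbd]; exact Or.inl (Or.inl ⟨r, hr, rfl⟩)
  have hup_mem : ∀ r ∈ Set.Icc 0 R, (r * Real.cos θ₁, r * Real.sin θ₁) ∈ bd := fun r hr => by
    rw [hbd]; exact Or.inl (Or.inr ⟨r, hr, rfl⟩)
  have harc_mem : ∀ θ ∈ Set.Icc (-θ₁) θ₁, (R * Real.cos θ, R * Real.sin θ) ∈ bd := fun θ hθ => by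
    rw [hbd]; exact Or.inr ⟨θ, hθ, rfl⟩
  have hrad : ∀ r, 0 ≤ r → r < R → r ^ 2 ≠ R ^ 2 := fun r h0 h1 h => by nlinarith
  have hν_low : ∀ r, 0 ≤ r → r < R →
      ν (r * Real.cos θ₁, -(r * Real.sin θ₁)) = (-Real.sin θ₁, -Real.cos θ₁) := fun r h0 h1 => by
    rw [hν _ (hlow_mem r ⟨h0, h1.le⟩), if_neg, if_pos]
    · exact neg_nonpos.2 (mul_nonneg h0 hs.le)
    · intro h
      apply hrad r h0 h1
      linear_combination h - r ^ 2 * hsc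
  have hν_up : ∀ r, 0 < r → r < R →
      ν (r * Real.cos θ₁, r * Real.sin θ₁) = (-Real.sin θ₁, Real.cos θ₁) := fun r h0 h1 => by
    rw [hν _ (hup_mem r ⟨h0.le, h1.le⟩), if_neg, if_neg]
    · exact not_le.2 (mul_pos h0 hs)
    · intro h
      apply hrad r h0.le h1
      linear_combination h - r ^ 2 * hsc
  have hν_arc : ∀ θ ∈ Set.Icc (-θ₁) θ₁,
      ν (R * Real.cos θ, R * Real.sin θ) = (Real.cos θ, Real.sin θ) := fun θ hθ => by
    rw [hν _ (harc_mem θ hθ), if_pos]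
    · simp [hR.ne']
    · linear_combination R ^ 2 * Real.sin_sq_add_cos_sq θ
  have hval : ∀ (x₀ : ℝ × ℝ), ∀ p ∈ bd, ∀ M : ℝ,
      x₀.1 * Real.sin θ₁ + x₀.2 * Real.cos θ₁ ≤ M →
      x₀.1 * Real.sin θ₁ - x₀.2 * Real.cos θ₁ ≤ M →
      (∀ θ ∈ Set.Icc (-θ₁) θ₁, R - x₀.1 * Real.cos θ - x₀.2 * Real.sin θ ≤ M) →
      (p.1 - x₀.1) * (ν p).1 + (p.2 - x₀.2) * (ν p).2 ≤ M := by
    intro x₀ p hp M h1 h2 h3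
    have harc : ∀ θ ∈ Set.Icc (-θ₁) θ₁, p = (R * Real.cos θ, R * Real.sin θ) →
        (p.1 - x₀.1) * (ν p).1 + (p.2 - x₀.2) * (ν p).2 ≤ M := by
      rintro θ hθ rfl
      rw [hν_arc θ hθ]
      linear_combination h3 θ hθ + R * Real.sin_sq_add_cos_sq θ
    have hp' := hp
    rw [hbd] at hp'
    obtain (⟨r, hr, rfl⟩ | ⟨r, hr, rfl⟩) | ⟨θ, hθ, rfl⟩ := hp'
    · rcases hr.2.lt_or_eq with h | rfl
      · dsimp only
        rw [hν_low r hr.1 h]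
        linear_combination h1
      · exact harc (-θ₁) ⟨le_rfl, by linarith⟩ (by simp)
    · rcases hr.2.lt_or_eq with h | rfl
      · rcases hr.1.lt_or_eq with h0 | rfl
        · dsimp only
          rw [hν_up r h0 h]
          linear_combination h2
        · have := hν_low 0 le_rfl h
          simp only [zero_mul, neg_zero] at this ⊢
          rw [this]
          linear_combination h1
      · exact harc θ₁ ⟨by linarith, le_rfl⟩ rfl
    · exact harc θ hθ rfl
  have hle : ∀ (x₀ : ℝ × ℝ), ∀ p ∈ bd,
      (p.1 - x₀.1) * (ν p).1 + (p.2 - x₀.2) * (ν p).2 ≤ g x₀ := by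
    intro x₀ p hp
    rw [hg]
    refine le_ciSup (f := fun x : bd => ((x : ℝ × ℝ).1 - x₀.1) * (ν x).1
      + ((x : ℝ × ℝ).2 - x₀.2) * (ν x).2) ?_ ⟨p, hp⟩
    refine ⟨R + |x₀.1| + |x₀.2|, ?_⟩
    have hmul : ∀ a t : ℝ, |t| ≤ 1 → |a * t| ≤ |a| := fun a t ht => by
      rw [abs_mul]
      exact mul_le_of_le_one_right (abs_nonneg a) ht
    have hS : ∀ a t : ℝ, |a * Real.sin t| ≤ |a| := fun a t => hmul a _ (Real.abs_sin_le_one t)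
    have hC : ∀ a t : ℝ, |a * Real.cos t| ≤ |a| := fun a t => hmul a _ (Real.abs_cos_le_one t)
    rintro _ ⟨x, rfl⟩
    refine hval x₀ x x.2 _ ?_ ?_ fun θ _ => ?_
    · linarith [abs_le.1 (hS x₀.1 θ₁), abs_le.1 (hC x₀.2 θ₁)]
    · linarith [abs_le.1 (hS x₀.1 θ₁), abs_le.1 (hC x₀.2 θ₁)]
    · linarith [abs_le.1 (hC x₀.1 θ), abs_le.1 (hS x₀.2 θ)]
  have hlower : ∀ x₀ : ℝ × ℝ,
      R * Real.sin θ₁ / (Real.cos θ₁ + Real.sin θ₁) ≤ g x₀ := by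
    intro x₀
    rw [div_le_iff₀ (by linarith)]
    have harc : ∀ θ ∈ Set.Icc (-θ₁) θ₁, R - x₀.1 * Real.cos θ - x₀.2 * Real.sin θ ≤ g x₀ := by
      intro θ hθ
      have h := hle x₀ _ (harc_mem θ hθ)
      rw [hν_arc θ hθ] at h
      linear_combination h - R * Real.sin_sq_add_cos_sq θ
    rcases le_total 0 x₀.2 with hb | hb
    · have h1 := harc (-θ₁) ⟨le_rfl, by linarith⟩
      have h2 := hle x₀ _ (hlow_mem 0 ⟨le_rfl, hR.le⟩)
      rw [hν_low 0 le_rfl hR] at h2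
      rw [Real.cos_neg, Real.sin_neg] at h1
      linear_combination Real.sin θ₁ * h1 + Real.cos θ₁ * h2 + hb - x₀.2 * hsc
    · have h1 := harc θ₁ ⟨by linarith, le_rfl⟩
      have h2 := hle x₀ _ (hup_mem (R / 2) ⟨by linarith, by linarith⟩)
      rw [hν_up (R / 2) (by linarith) (by linarith)] at h2
      linear_combination Real.sin θ₁ * h1 + Real.cos θ₁ * h2 + hb + x₀.2 * hsc
  refine ⟨fun x₀ _ => hlower x₀, le_antisymm ?_ (hlower _), ?_⟩
  · rw [hg]
    have : Nonempty bd := ⟨⟨_, hlow_mem 0 ⟨le_rfl, hR.le⟩⟩⟩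
    refine ciSup_le fun x => hval _ x x.2 _ ?_ ?_ fun θ hθ => ?_
    · exact le_of_eq (by ring)
    · exact le_of_eq (by ring)
    · have hcos : Real.cos θ₁ ≤ Real.cos θ := by
        rw [← Real.cos_abs θ]
        exact Real.cos_le_cos_of_nonneg_of_le_pi (abs_nonneg θ) (by linarith [Real.pi_pos])
          (abs_le.2 hθ)
      have hpos : 0 < Real.cos θ₁ + Real.sin θ₁ := by linarith
      have hq : R * Real.sin θ₁ / (Real.cos θ₁ + Real.sin θ₁)
          = R - R / (Real.cos θ₁ + Real.sin θ₁) * Real.cos θ₁ := by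
        field_simp
        ring
      rw [hq]
      have := mul_le_mul_of_nonneg_left hcos (div_pos hR hpos).le
      dsimp only
      linarith
  · rw [hΩcl]
    refine ⟨R / (Real.cos θ₁ + Real.sin θ₁), 0, ⟨by positivity, div_le_self hR.le hsum⟩,
      ⟨by linarith, hθ0.le⟩, by simp⟩
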